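/- The point (0,0) is a fixed point of the map F, and the (total) derivative of F at (0,0) is the zero map; that is, the fixed point [0:0:1] of the rational map f of ℙ² is superattracting. (By the symmetry of f in the homogeneous coordinates, the same holds for the fixed points [1:0:0] and [0:1:0].) -/

import Mathlib

/-- Affine-chart representation of f = g∘h. -/
noncomputable def F (p : ℝ × ℝ) : ℝ × ℝ :=
  (p.1 ^ 2 * (-p.1 + p.2 + 1) ^ 2 / (p.1 + p.2 - 1) ^ 2,
   p.2 ^ 2 * (p.1 - p.2 + 1) ^ 2 / (p.1 + p.2 - 1) ^ 2)

/-- A product `a ^ 2 * u` has zero derivative where `a` vanishes. -/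
theorem hasFDerivAt_sq_mul_zero {a u : ℝ × ℝ → ℝ} {x : ℝ × ℝ}
    (ha : DifferentiableAt ℝ a x) (hu : DifferentiableAt ℝ u x) (h0 : a x = 0) :
    HasFDerivAt (fun p => a p ^ 2 * u p) (0 : ℝ × ℝ →L[ℝ] ℝ) x := by
  have h := ha.hasFDerivAt.mul (ha.hasFDerivAt.mul hu.hasFDerivAt)
  have e : (fun p => a p ^ 2 * u p) = a * (a * u) := by
    funext p
    simp only [Pi.mul_apply]
    ring
  rw [e]
  refine h.congr_fderiv ?_
  ext <;> simp [h0]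

/-- The genuine (Fréchet) derivative of `F` at the origin exists and is zero. -/
theorem hasFDerivAt_F_zero : HasFDerivAt F (0 : ℝ × ℝ →L[ℝ] ℝ × ℝ) (0, 0) := by
  have h1 : HasFDerivAt (fun p : ℝ × ℝ =>
      p.1 ^ 2 * ((-p.1 + p.2 + 1) ^ 2 / (p.1 + p.2 - 1) ^ 2))
      (0 : ℝ × ℝ →L[ℝ] ℝ) (0, 0) := by
    refine hasFDerivAt_sq_mul_zero (a := fun p => p.1) (by fun_prop) ?_ rfl
    fun_prop (disch := norm_num)
  have h2 : HasFDerivAt (fun p : ℝ × ℝ =>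
      p.2 ^ 2 * ((p.1 - p.2 + 1) ^ 2 / (p.1 + p.2 - 1) ^ 2))
      (0 : ℝ × ℝ →L[ℝ] ℝ) (0, 0) := by
    refine hasFDerivAt_sq_mul_zero (a := fun p => p.2) (by fun_prop) ?_ rfl
    fun_prop (disch := norm_num)
  have h := h1.prodMk h2
  have e : F = fun p : ℝ × ℝ =>
      (p.1 ^ 2 * ((-p.1 + p.2 + 1) ^ 2 / (p.1 + p.2 - 1) ^ 2),
       p.2 ^ 2 * ((p.1 - p.2 + 1) ^ 2 / (p.1 + p.2 - 1) ^ 2)) := by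
    funext p
    simp only [F, mul_div_assoc]
  rw [e]
  exact h.congr_fderiv rfl

/-- (0,0) is a fixed point of F with vanishing derivative: the fixed point
[0:0:1] of f is superattracting. -/
theorem stmt_10 :
    F (0, 0) = (0, 0) ∧ fderiv ℝ F (0, 0) = 0 := by
  exact ⟨by simp [F], hasFDerivAt_F_zero.fderiv⟩
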